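/- Let H be an infinite-dimensional complex Hilbert space and M ⊆ H a norm-compact set with 0 ∉ M. Then for every unitary operator U on H, every finite set F ⊆ H, and every ε > 0, there exists a unitary operator V on H such that ‖Vf − Uf‖ ≤ ε for all f ∈ F and V(M) ∩ M = ∅. -/

import Mathlib

/-- A finite-dimensional subspace of an infinite-dimensional inner product space embeds
isometrically into its own orthogonal complement. -/
theorem exists_linearIsometry_orthogonal {H : Type*} [NormedAddCommGroup H]
    [InnerProductSpace ℂ H] (hdim : ¬ FiniteDimensional ℂ H)
    (E : Submodule ℂ H) [FiniteDimensional ℂ E] :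
    ∃ W : E →ₗᵢ[ℂ] H, ∀ x y : E, inner ℂ (x : H) (W y) = 0 := by
  have hE : ¬ FiniteDimensional ℂ Eᗮ := by
    intro h
    have htop : E ⊔ Eᗮ = ⊤ := E.sup_orthogonal_of_hasOrthogonalProjection
    apply hdim
    have : FiniteDimensional ℂ (⊤ : Submodule ℂ H) := htop ▸ Submodule.finiteDimensional_sup E Eᗮ
    exact Module.finite_def.mpr (Module.Finite.iff_fg.mp this)
  have hrank : (Module.finrank ℂ E : Cardinal) ≤ Module.rank ℂ Eᗮ := by
    refine (Cardinal.natCast_lt_aleph0).le.trans ?_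
    rw [← not_lt]
    exact fun h => hE (Module.rank_lt_aleph0_iff.mp h)
  obtain ⟨v, hv⟩ := Module.le_rank_iff.mp hrank
  let b := stdOrthonormalBasis ℂ E
  let f : E →ₗ[ℂ] Eᗮ := b.toBasis.constr ℂ (InnerProductSpace.gramSchmidtNormed ℂ v)
  have hf : f ∘ b.toBasis = InnerProductSpace.gramSchmidtNormed ℂ v :=
    funext fun i => b.toBasis.constr_basis ℂ _ i
  let W : E →ₗᵢ[ℂ] Eᗮ := f.isometryOfOrthonormal (v := b.toBasis) (by simp [b.orthonormal])
    (hf ▸ InnerProductSpace.gramSchmidtNormed_orthonormal hv)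
  exact ⟨Eᗮ.subtypeₗᵢ.comp W, fun x y => (W y).2 x x.2⟩

open Submodule in
/-- Given a finite-dimensional subspace `E`, the reflection in the graph
`{x + s W x | x ∈ E}` of an isometry `W : E → Eᗮ` tilts `E` towards `Eᗮ`. -/
theorem exists_linearIsometryEquiv_tilt {H : Type*} [NormedAddCommGroup H]
    [InnerProductSpace ℂ H] (E : Submodule ℂ H) [FiniteDimensional ℂ E]
    (W : E →ₗᵢ[ℂ] H) (hW : ∀ x y : E, inner ℂ (x : H) (W y) = 0) (s : ℝ) :
    ∃ R : H ≃ₗᵢ[ℂ] H, ∀ x : E,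
      R x = ((1 - s ^ 2) / (1 + s ^ 2) : ℝ) • (x : H) + (2 * s / (1 + s ^ 2) : ℝ) • W x := by
  have hs : (1 + s ^ 2) ≠ 0 := by positivity
  let T : E →ₗ[ℂ] H := E.subtype + (s : ℂ) • W.toLinearMap
  have hT : ∀ x, T x = (x : H) + s • W x := fun x => by simp [T]
  have hW' : ∀ x y : E, inner ℂ (W y) (x : H) = 0 := fun x y => by
    rw [← inner_conj_symm, hW, map_zero]
  refine ⟨(LinearMap.range T).reflection, fun x => ?_⟩
  have hmem : T x ∈ LinearMap.range T := ⟨x, rfl⟩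
  have horth : s • (x : H) - W x ∈ (LinearMap.range T)ᗮ := by
    rintro _ ⟨y, rfl⟩
    rw [hT]
    simp only [inner_add_left, inner_sub_right, ← Complex.coe_smul, inner_smul_left,
      inner_smul_right, hW, hW', W.inner_map_map, Submodule.coe_inner, Complex.conj_ofReal]
    ring
  have hx : (x : H) = (1 / (1 + s ^ 2) : ℝ) • T x + (s / (1 + s ^ 2) : ℝ) • (s • (x : H) - W x) := by
    rw [hT]
    match_scalars <;> field_simp <;> ring
  have h1 := reflection_mem_subspace_eq_self hmem
  have h2 := reflection_mem_subspace_orthogonalComplement_eq_neg horth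
  have h3 : ∀ (a : ℝ) (v : H), (LinearMap.range T).reflection (a • v) =
      a • (LinearMap.range T).reflection v := fun a v => by
    rw [← Complex.coe_smul, map_smul, Complex.coe_smul]
  conv_lhs => rw [hx, map_add, h3, h3, h1, h2, hT]
  match_scalars <;> field_simp <;> ring

/-- A compact set lies arbitrarily close to some finite-dimensional subspace containing a given
finite set. -/
theorem IsCompact.exists_finiteDimensional_near {H : Type*} [NormedAddCommGroup H]
    [InnerProductSpace ℂ H] {K : Set H} (hK : IsCompact K) {F : Set H} (hF : F.Finite)
    {η : ℝ} (hη : 0 < η) :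
    ∃ E : Submodule ℂ H, FiniteDimensional ℂ E ∧ F ⊆ E ∧ ∀ x ∈ K, ∃ e : E, ‖x - e‖ < η := by
  obtain ⟨t, ht, hKt⟩ := Metric.totallyBounded_iff.mp hK.totallyBounded η hη
  refine ⟨Submodule.span ℂ (F ∪ t), FiniteDimensional.span_of_finite ℂ (hF.union ht),
    Set.subset_union_left.trans Submodule.subset_span, fun x hx => ?_⟩
  obtain ⟨y, hy, hxy⟩ := Set.mem_iUnion₂.mp (hKt hx)
  exact ⟨⟨y, Submodule.subset_span (Or.inr hy)⟩, by simpa [dist_eq_norm] using hxy⟩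

/-- In an infinite-dimensional complex Hilbert space, for every norm-compact `M` with `0 ∉ M`,
every unitary `U`, finite `F ⊆ H` and `ε > 0`, there is a unitary `V` with
`‖Vf − Uf‖ ≤ ε` on `F` and `V(M) ∩ M = ∅`. -/
theorem stmt7 {H : Type*} [NormedAddCommGroup H] [InnerProductSpace ℂ H] [CompleteSpace H]
    (hdim : ¬ FiniteDimensional ℂ H)
    (M : Set H) (hM : IsCompact M) (h0 : (0 : H) ∉ M)
    (U : H →L[ℂ] H) (hUiso : ∀ x, ‖U x‖ = ‖x‖) (hUsurj : Function.Surjective U)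
    (F : Finset H) (ε : ℝ) (hε : 0 < ε) :
    ∃ V : H →L[ℂ] H, (∀ x, ‖V x‖ = ‖x‖) ∧ Function.Surjective V ∧
      (∀ f ∈ F, ‖V f - U f‖ ≤ ε) ∧ V '' M ∩ M = ∅ := by
  obtain ⟨c, hc, hcM⟩ : ∃ c > 0, ∀ m ∈ M, c ≤ ‖m‖ := by
    obtain ⟨c, hc, h⟩ := Metric.isOpen_iff.mp hM.isClosed.isOpen_compl 0 h0
    exact ⟨c, hc, fun m hm => not_lt.mp fun hlt => h (by simpa using hlt) hm⟩
  set B : ℝ := ∑ f ∈ F, ‖f‖ with hB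
  have hB0 : 0 ≤ B := Finset.sum_nonneg fun _ _ => norm_nonneg _
  obtain ⟨s, hs, hs1, hsB⟩ : ∃ s : ℝ, 0 < s ∧ s ≤ 1 ∧ 4 * s * B ≤ ε := by
    refine ⟨min 1 (ε / (4 * (B + 1))), by positivity, min_le_left _ _, ?_⟩
    have h := (le_div_iff₀ (by positivity)).mp (min_le_right 1 (ε / (4 * (B + 1))))
    have h' : 0 < min 1 (ε / (4 * (B + 1))) := by positivity
    nlinarith
  set δ : ℝ := 2 * s / (1 + s ^ 2) with hδ
  have hδ0 : 0 < δ := by positivity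
  have hδ1 : δ ≤ 1 := by rw [hδ, div_le_one (by positivity)]; nlinarith [sq_nonneg (s - 1)]
  have hδs : δ ≤ 2 * s := div_le_self (by positivity) (by nlinarith)
  obtain ⟨E, hE, hFE, hnear⟩ := (hM.union (hM.image U.continuous)).exists_finiteDimensional_near
    (F.finite_toSet.image U) (show 0 < δ * c / 3 by positivity)
  obtain ⟨W, hW⟩ := exists_linearIsometry_orthogonal hdim E
  obtain ⟨R, hR⟩ := exists_linearIsometryEquiv_tilt E W hW s
  refine ⟨R.toContinuousLinearEquiv.toContinuousLinearMap.comp U, fun x => by simp [hUiso],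
    R.surjective.comp hUsurj, fun f hf => ?_, ?_⟩
  · have hx := hR ⟨U f, hFE ⟨f, hf, rfl⟩⟩
    have hfB : ‖f‖ ≤ B := Finset.single_le_sum (f := fun g : H => ‖g‖) (fun _ _ => norm_nonneg _) hf
    have key : R (U f) - U f = δ • (W ⟨U f, hFE ⟨f, hf, rfl⟩⟩ - s • U f) := by
      rw [hx]
      match_scalars <;> simp only [hδ] <;> field_simp <;> ring
    change ‖R (U f) - U f‖ ≤ ε
    rw [key, norm_smul, Real.norm_of_nonneg hδ0.le]
    calc δ * ‖W ⟨U f, hFE ⟨f, hf, rfl⟩⟩ - s • U f‖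
        ≤ δ * (‖W ⟨U f, hFE ⟨f, hf, rfl⟩⟩‖ + ‖s • U f‖) := by gcongr; exact norm_sub_le _ _
      _ = δ * (‖f‖ + s * ‖f‖) := by
        rw [W.norm_map, norm_smul, Real.norm_of_nonneg hs.le, Submodule.coe_norm, hUiso]
      _ ≤ 2 * s * (B + 1 * B) := by gcongr
      _ ≤ ε := by linarith
  · rw [Set.eq_empty_iff_forall_notMem]
    rintro _ ⟨⟨m, hm, rfl⟩, hm'⟩
    change R (U m) ∈ M at hm'
    obtain ⟨e, he⟩ := hnear (U m) (Or.inr ⟨m, hm, rfl⟩)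
    obtain ⟨e', he'⟩ := hnear _ (Or.inl hm')
    have hlow : δ * ‖e‖ ≤ ‖R e - e'‖ := by
      set a : ℝ := (1 - s ^ 2) / (1 + s ^ 2)
      have hdec : R e - e' = ((a • e - e' : E) : H) + W (δ • e) := by
        rw [hR]
        have : W (δ • e) = δ • W e := by
          rw [← Complex.coe_smul, map_smul, Complex.coe_smul]
        rw [this]
        push_cast
        abel
      have hpyth := norm_add_sq_eq_norm_sq_add_norm_sq_of_inner_eq_zero _ _ (hW (a • e - e') (δ • e))
      rw [← hdec, W.norm_map, norm_smul, Real.norm_of_nonneg hδ0.le] at hpyth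
      refine le_of_sq_le_sq ?_ (norm_nonneg _)
      nlinarith [mul_self_nonneg ‖((a • e - e' : E) : H)‖]
    have hup : ‖R e - e'‖ ≤ ‖U m - e‖ + ‖R (U m) - e'‖ := by
      rw [← R.norm_map (U m - e), map_sub, norm_sub_rev (R (U m)) (R e)]
      exact norm_sub_le_norm_sub_add_norm_sub _ _ _
    have hem : c ≤ ‖U m - e‖ + ‖e‖ := by
      calc c ≤ ‖U m‖ := (hUiso m).symm ▸ hcM m hm
        _ ≤ ‖U m - e‖ + ‖(e : H)‖ := norm_le_norm_sub_add _ _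
    have hδc := mul_le_mul_of_nonneg_left hem hδ0.le
    have hδe := mul_le_of_le_one_left (norm_nonneg (U m - e)) hδ1
    linarith
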